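/- arXiv:2311.13528 — 2 statements merged into one kernel-verified Lean document; each statement's English description precedes it below -/
import Mathlib

section
/- For all R ∈ [0,1], θ ∈ [0, π/4] and α₀, α₁, β₀, β₁ ∈ ℝ, the CHSH score satisfies S(R, θ, α₀, α₁, β₀, β₁) ≤ 1/2 + (R/4)·(|cos(α₀ − α₁)|·√(1 + cos(2α₀ + 2α₁)·sin(2θ)) + |sin(α₀ − α₁)|·√(1 − cos(2α₀ + 2α₁)·sin(2θ))). -/
open Real

noncomputable def eps00 (R θ a0 a1 b0 b1 : ℝ) : ℝ :=
  (1 + R * Real.cos θ * Real.cos (2 * (a0 - b0))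
     + R * Real.sin θ * Real.cos (2 * (a0 + b0))) / 4

noncomputable def eps01 (R θ a0 a1 b0 b1 : ℝ) : ℝ :=
  (1 + R * Real.cos θ * Real.cos (2 * (a0 - b1))
     + R * Real.sin θ * Real.cos (2 * (a0 + b1))) / 4

noncomputable def eps10 (R θ a0 a1 b0 b1 : ℝ) : ℝ :=
  (1 + R * Real.cos θ * Real.cos (2 * (a1 - b0))
     + R * Real.sin θ * Real.cos (2 * (a1 + b0))) / 4

noncomputable def eps11 (R θ a0 a1 b0 b1 : ℝ) : ℝ :=
  (1 - R * Real.cos θ * Real.cos (2 * (a1 - b1))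
     - R * Real.sin θ * Real.cos (2 * (a1 + b1))) / 4

/-- The CHSH score of the qubit strategy with parameters `R, θ, α₀, α₁, β₀, β₁`. -/
noncomputable def chshS (R θ a0 a1 b0 b1 : ℝ) : ℝ :=
  (eps00 R θ a0 a1 b0 b1 + eps01 R θ a0 a1 b0 b1
    + eps10 R θ a0 a1 b0 b1 + eps11 R θ a0 a1 b0 b1) / 2

/-- Cauchy–Schwarz bound for a superposition of two counter-rotating cosines. -/
theorem abs_cos_mul_cos_sub_add_sin_mul_cos_add_le (θ s t : ℝ) :
    |Real.cos θ * Real.cos (s - t) + Real.sin θ * Real.cos (s + t)| ≤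
      Real.sqrt (1 + Real.cos (2 * s) * Real.sin (2 * θ)) := by
  apply Real.abs_le_sqrt
  have hs := Real.sin_sq_add_cos_sq s
  have ht := Real.sin_sq_add_cos_sq t
  have hθ := Real.sin_sq_add_cos_sq θ
  rw [Real.cos_sub, Real.cos_add, Real.cos_two_mul', Real.sin_two_mul]
  generalize Real.cos s = x at *
  generalize Real.sin s = y at *
  generalize Real.cos t = u at *
  generalize Real.sin t = v at *
  generalize Real.cos θ = c at *
  generalize Real.sin θ = d at *
  have key : 1 + (x ^ 2 - y ^ 2) * (2 * d * c)
      - (c * (x * u + y * v) + d * (x * u - y * v)) ^ 2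
      = (x * (c + d) * v - y * (c - d) * u) ^ 2 := by
    linear_combination (-(x ^ 2 * (c + d) ^ 2 + y ^ 2 * (c - d) ^ 2)) * ht
      - (x ^ 2 + y ^ 2) * hθ - hs
  linarith [sq_nonneg (x * (c + d) * v - y * (c - d) * u)]

/-- The version of `abs_cos_mul_cos_sub_add_sin_mul_cos_add_le` for sines. -/
theorem abs_cos_mul_sin_sub_add_sin_mul_sin_add_le (θ s t : ℝ) :
    |Real.cos θ * Real.sin (s - t) + Real.sin θ * Real.sin (s + t)| ≤
      Real.sqrt (1 - Real.cos (2 * s) * Real.sin (2 * θ)) := by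
  have h := abs_cos_mul_cos_sub_add_sin_mul_cos_add_le θ (s - π / 2) t
  rw [show s - π / 2 - t = s - t - π / 2 by ring, show s - π / 2 + t = s + t - π / 2 by ring,
    show 2 * (s - π / 2) = 2 * s - π by ring, Real.cos_sub_pi_div_two,
    Real.cos_sub_pi_div_two, Real.cos_sub_pi, neg_mul, ← sub_eq_add_neg] at h
  exact h

/-- The CHSH score with the contributions of Bob's two angles separated. -/
theorem chshS_eq (R θ a0 a1 b0 b1 : ℝ) :
    chshS R θ a0 a1 b0 b1 = 1 / 2 + R / 4 *
      (Real.cos (a0 - a1) * (Real.cos θ * Real.cos (a0 + a1 - 2 * b0)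
          + Real.sin θ * Real.cos (a0 + a1 + 2 * b0))
        - Real.sin (a0 - a1) * (Real.cos θ * Real.sin (a0 + a1 - 2 * b1)
          + Real.sin θ * Real.sin (a0 + a1 + 2 * b1))) := by
  have hadd (t : ℝ) : Real.cos (2 * (a0 + t)) + Real.cos (2 * (a1 + t))
      = 2 * Real.cos (a0 + a1 + 2 * t) * Real.cos (a0 - a1) := by
    rw [Real.cos_add_cos]; ring_nf
  have hsub (t : ℝ) : Real.cos (2 * (a0 + t)) - Real.cos (2 * (a1 + t))
      = -2 * Real.sin (a0 + a1 + 2 * t) * Real.sin (a0 - a1) := by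
    rw [Real.cos_sub_cos]; ring_nf
  have hadd' := hadd (-b0)
  have hsub' := hsub (-b1)
  simp only [mul_neg, ← sub_eq_add_neg] at hadd' hsub'
  unfold chshS eps00 eps01 eps10 eps11
  linear_combination R / 8 * (Real.cos θ * (hadd' + hsub') + Real.sin θ * (hadd b0 + hsub b1))

/-- Bound on the CHSH score in terms of Alice's angles only. -/
theorem chsh_score_bound_alice (R θ a0 a1 b0 b1 : ℝ)
    (hR0 : 0 ≤ R) (hR1 : R ≤ 1) (hθ0 : 0 ≤ θ) (hθ1 : θ ≤ π / 4) :
    chshS R θ a0 a1 b0 b1 ≤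
      1 / 2 + R / 4 *
        (|Real.cos (a0 - a1)| * Real.sqrt (1 + Real.cos (2 * a0 + 2 * a1) * Real.sin (2 * θ)) +
         |Real.sin (a0 - a1)| * Real.sqrt (1 - Real.cos (2 * a0 + 2 * a1) * Real.sin (2 * θ))) := by
  rw [chshS_eq, show 2 * a0 + 2 * a1 = 2 * (a0 + a1) by ring]
  have hcos := abs_cos_mul_cos_sub_add_sin_mul_cos_add_le θ (a0 + a1) (2 * b0)
  have hsin := abs_cos_mul_sin_sub_add_sin_mul_sin_add_le θ (a0 + a1) (2 * b1)
  gcongr 1 / 2 + R / 4 * ?_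
  rw [sub_eq_add_neg]
  refine add_le_add ((le_abs_self _).trans ?_) ((neg_le_abs _).trans ?_) <;> rw [abs_mul] <;> gcongr
end

section
/- The function K(R, θ) is monotonically nondecreasing in R: for all R₁, R₂ with 1/√2 < R₁ ≤ R₂ ≤ 1 and all θ ∈ [0, π/4 − arccos(1/(√2·R₁))], one has K(R₁, θ) ≤ K(R₂, θ). -/
open Real

/-- `ent x = -x·log₂ x`, with the convention `0·log₂ 0 = 0`. -/
noncomputable def ent (x : ℝ) : ℝ := -(x * Real.logb 2 x)

/-- Shannon entropy (base 2) of a probability vector of length 4. -/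
noncomputable def H4 (a b c d : ℝ) : ℝ := ent a + ent b + ent c + ent d

noncomputable def lam0 (R θ δ : ℝ) : ℝ := 1 / 4 + R * Real.cos θ / 2 + δ
noncomputable def lam1 (R θ δ : ℝ) : ℝ := 1 / 4 + R * Real.sin θ / 2 - δ
noncomputable def lam2 (R θ δ : ℝ) : ℝ := 1 / 4 - R * Real.sin θ / 2 - δ
noncomputable def lam3 (R θ δ : ℝ) : ℝ := 1 / 4 - R * Real.cos θ / 2 + δ

/-- `δ* = R²·cos(2θ)/4`. -/
noncomputable def dstar (R θ : ℝ) : ℝ := R ^ 2 * Real.cos (2 * θ) / 4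

/-- `K(R,θ) = 1 − H(λ₀,λ₁,λ₂,λ₃)` evaluated at `δ = δ*`. -/
noncomputable def Kfun (R θ : ℝ) : ℝ :=
  1 - H4 (lam0 R θ (dstar R θ)) (lam1 R θ (dstar R θ))
         (lam2 R θ (dstar R θ)) (lam3 R θ (dstar R θ))

theorem ent_mul (x y : ℝ) : ent (x * y) = x * ent y + y * ent x := by
  unfold ent
  rcases eq_or_ne x 0 with rfl | hx
  · simp
  rcases eq_or_ne y 0 with rfl | hy
  · simp
  rw [Real.logb_mul hx hy]
  ring

theorem ent_add_ent_one_sub (x : ℝ) : ent x + ent (1 - x) = Real.binEntropy x / Real.log 2 := by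
  simp only [ent, Real.logb, Real.binEntropy, Real.log_inv]
  ring

/-- The entropy of a product of two binary distributions is the sum of their entropies. -/
theorem H4_product (x y : ℝ) :
    H4 (x * y) (x * (1 - y)) ((1 - x) * y) ((1 - x) * (1 - y)) =
      (Real.binEntropy x + Real.binEntropy y) / Real.log 2 := by
  rw [add_div, ← ent_add_ent_one_sub, ← ent_add_ent_one_sub]
  simp only [H4, ent_mul]
  ring

/-- Since `Real.log` is even, the binary entropy keeps decreasing beyond `1`. -/
theorem antitoneOn_binEntropy_Ici : AntitoneOn Real.binEntropy (Set.Ici 2⁻¹) := by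
  have h : AntitoneOn Real.binEntropy (Set.Ici 1) := by
    refine antitoneOn_of_deriv_nonpos (convex_Ici 1) Real.binEntropy_continuous.continuousOn ?_ ?_
    · intro x hx
      rw [interior_Ici, Set.mem_Ioi] at hx
      exact (Real.differentiableAt_binEntropy (by linarith) hx.ne').differentiableWithinAt
    · intro x hx
      rw [interior_Ici, Set.mem_Ioi] at hx
      rw [Real.deriv_binEntropy, ← Real.log_neg_eq_log, sub_nonpos]
      exact Real.log_le_log (by linarith) (by linarith)
  rw [← Set.Icc_union_Ici_eq_Ici (by norm_num : (2⁻¹ : ℝ) ≤ 1)]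
  exact Real.binEntropy_strictAntiOn.antitoneOn.union_right h (isGreatest_Icc (by norm_num))
    isLeast_Ici

/-- The distribution at `δ*` is a product of two binary distributions. -/
theorem Kfun_eq_binEntropy (R θ : ℝ) :
    Kfun R θ = 1 - (Real.binEntropy ((1 + R * (Real.cos θ + Real.sin θ)) / 2) +
      Real.binEntropy ((1 + R * (Real.cos θ - Real.sin θ)) / 2)) / Real.log 2 := by
  rw [Kfun, ← H4_product, lam0, lam1, lam2, lam3, dstar, Real.cos_two_mul']
  congr 2 <;> ring

/-- `K(R,θ)` is monotonically nondecreasing in `R`. -/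
theorem Kfun_mono_R (R₁ R₂ θ : ℝ)
    (hR₁ : 1 / Real.sqrt 2 < R₁) (hR : R₁ ≤ R₂) (hR₂ : R₂ ≤ 1)
    (hθ0 : 0 ≤ θ) (hθ1 : θ ≤ π / 4 - Real.arccos (1 / (Real.sqrt 2 * R₁))) :
    Kfun R₁ θ ≤ Kfun R₂ θ := by
  have hθ : θ ≤ π / 4 := hθ1.trans (sub_le_self _ (Real.arccos_nonneg _))
  have hR₁0 : 0 ≤ R₁ := le_trans (by positivity) hR₁.le
  have hs : 0 ≤ Real.sin θ := Real.sin_nonneg_of_nonneg_of_le_pi hθ0 (by linarith [Real.pi_pos])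
  have hsc : Real.sin θ ≤ Real.cos θ := by
    rw [← Real.sin_pi_div_two_sub]
    exact Real.sin_le_sin_of_le_of_le_pi_div_two (by linarith [Real.pi_pos])
      (by linarith) (by linarith)
  have key (t : ℝ) (ht : 0 ≤ t) :
      Real.binEntropy ((1 + R₂ * t) / 2) ≤ Real.binEntropy ((1 + R₁ * t) / 2) := by
    have h₁ : 0 ≤ R₁ * t := mul_nonneg hR₁0 ht
    have h₂ : R₁ * t ≤ R₂ * t := mul_le_mul_of_nonneg_right hR ht
    refine antitoneOn_binEntropy_Ici ?_ ?_ ?_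
    · rw [Set.mem_Ici]; linarith
    · rw [Set.mem_Ici]; linarith
    · linarith
  rw [Kfun_eq_binEntropy, Kfun_eq_binEntropy]
  have hlog : 0 ≤ Real.log 2 := Real.log_nonneg one_le_two
  gcongr 1 - (?_ + ?_) / _
  · exact key _ (by linarith)
  · exact key _ (by linarith)
end
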